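/- arXiv:1606.04589 — 2 statements merged into one kernel-verified Lean document; each statement's English description precedes it below -/
import Mathlib

section
/- Any ES basic fusion operator that satisfies (ESF-SD), (ESF7), (ESF8W) and (ESF-I) also satisfies (ESF-D). -/
/- Common framework for logic-based merging of epistemic states
   (Mata Díaz & Pino Pérez, "Impossibility in Belief Merging"). -/

namespace BeliefMerging

/-- A profile: a nonempty finite society of agents together with an
assignment of an epistemic state to each agent of the society. -/
structure Profile (S ℰ : Type) where
  soc : Finset S
  soc_nonempty : soc.Nonempty
  val : {x // x ∈ soc} → ℰ

variable {S ℰ W : Type}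

/-- The singleton profile of agent `i` with epistemic state `E`. -/
def Profile.single (i : S) (E : ℰ) : Profile S ℰ :=
  ⟨{i}, Finset.singleton_nonempty i, fun _ => E⟩

/-- Restriction of a profile to a nonempty subsociety. -/
def Profile.restrict (Φ : Profile S ℰ) (M : Finset S) (hM : M.Nonempty)
    (hsub : M ⊆ Φ.soc) : Profile S ℰ :=
  ⟨M, hM, fun i => Φ.val ⟨i.1, hsub i.2⟩⟩

/-- Equivalence of profiles: societies of the same cardinality whose states
correspond under the unique order-preserving bijection. -/
def Profile.Equiv [LinearOrder S] (Φ Ψ : Profile S ℰ) : Prop :=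
  ∃ h : Φ.soc.card = Ψ.soc.card,
    ∀ k : Fin Φ.soc.card,
      Φ.val (Φ.soc.orderIsoOfFin rfl k) = Ψ.val (Ψ.soc.orderIsoOfFin h.symm k)

/-- (ESF1) -/
def ESF1 (B : ℰ → Set W) (nab : Profile S ℰ → ℰ → ℰ) : Prop :=
  ∀ (Φ : Profile S ℰ) (E : ℰ), B (nab Φ E) ⊆ B E

/-- (ESF2) -/
def ESF2 [LinearOrder S] (B : ℰ → Set W) (nab : Profile S ℰ → ℰ → ℰ) : Prop :=
  ∀ (Φ Φ' : Profile S ℰ) (E E' : ℰ), Profile.Equiv Φ Φ' → B E = B E' →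
    B (nab Φ E) = B (nab Φ' E')

/-- (ESF3) -/
def ESF3 (B : ℰ → Set W) (nab : Profile S ℰ → ℰ → ℰ) : Prop :=
  ∀ (Φ : Profile S ℰ) (E E' E'' : ℰ), B E = B E' ∩ B E'' →
    B (nab Φ E') ∩ B E'' ⊆ B (nab Φ E)

/-- (ESF4) -/
def ESF4 (B : ℰ → Set W) (nab : Profile S ℰ → ℰ → ℰ) : Prop :=
  ∀ (Φ : Profile S ℰ) (E E' E'' : ℰ), B E = B E' ∩ B E'' →
    (B (nab Φ E') ∩ B E'').Nonempty →
    B (nab Φ E) ⊆ B (nab Φ E') ∩ B E''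

/-- ES basic fusion operator: (ESF1)–(ESF4). -/
def BasicFusion [LinearOrder S] (B : ℰ → Set W) (nab : Profile S ℰ → ℰ → ℰ) : Prop :=
  ESF1 B nab ∧ ESF2 B nab ∧ ESF3 B nab ∧ ESF4 B nab

/-- (ESF5) -/
def ESF5 (B : ℰ → Set W) (nab : Profile S ℰ → ℰ → ℰ) : Prop :=
  ∀ (j k : S) (Ej Ek : ℰ), Ej ≠ Ek →
    ∃ E' : ℰ, B (nab (Profile.single j Ej) E') ≠ B (nab (Profile.single k Ek) E')

/-- (ESF6) -/
def ESF6 (B : ℰ → Set W) (nab : Profile S ℰ → ℰ → ℰ) : Prop :=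
  ∀ (Φ : Profile S ℰ) (E : ℰ),
    ((⋂ i : {x // x ∈ Φ.soc}, B (Φ.val i)) ∩ B E).Nonempty →
    B (nab Φ E) = (⋂ i : {x // x ∈ Φ.soc}, B (Φ.val i)) ∩ B E

/-- (ESF7) -/
def ESF7 [DecidableEq S] (B : ℰ → Set W) (nab : Profile S ℰ → ℰ → ℰ) : Prop :=
  ∀ (Φ : Profile S ℰ) (N₁ N₂ : Finset S) (h₁ : N₁.Nonempty) (h₂ : N₂.Nonempty)
    (hs₁ : N₁ ⊆ Φ.soc) (hs₂ : N₂ ⊆ Φ.soc),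
    Disjoint N₁ N₂ → N₁ ∪ N₂ = Φ.soc → ∀ E : ℰ,
      B (nab (Φ.restrict N₁ h₁ hs₁) E) ∩ B (nab (Φ.restrict N₂ h₂ hs₂) E) ⊆
        B (nab Φ E)

/-- (ESF8) -/
def ESF8 [DecidableEq S] (B : ℰ → Set W) (nab : Profile S ℰ → ℰ → ℰ) : Prop :=
  ∀ (Φ : Profile S ℰ) (N₁ N₂ : Finset S) (h₁ : N₁.Nonempty) (h₂ : N₂.Nonempty)
    (hs₁ : N₁ ⊆ Φ.soc) (hs₂ : N₂ ⊆ Φ.soc),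
    Disjoint N₁ N₂ → N₁ ∪ N₂ = Φ.soc → ∀ E : ℰ,
      (B (nab (Φ.restrict N₁ h₁ hs₁) E) ∩ B (nab (Φ.restrict N₂ h₂ hs₂) E)).Nonempty →
      B (nab Φ E) ⊆
        B (nab (Φ.restrict N₁ h₁ hs₁) E) ∩ B (nab (Φ.restrict N₂ h₂ hs₂) E)

/-- (ESF8W) -/
def ESF8W [DecidableEq S] (B : ℰ → Set W) (nab : Profile S ℰ → ℰ → ℰ) : Prop :=
  ∀ (Φ : Profile S ℰ) (N₁ N₂ : Finset S) (h₁ : N₁.Nonempty) (h₂ : N₂.Nonempty)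
    (hs₁ : N₁ ⊆ Φ.soc) (hs₂ : N₂ ⊆ Φ.soc),
    Disjoint N₁ N₂ → N₁ ∪ N₂ = Φ.soc → ∀ E : ℰ,
      (B (nab (Φ.restrict N₁ h₁ hs₁) E) ∩ B (nab (Φ.restrict N₂ h₂ hs₂) E)).Nonempty →
      B (nab Φ E) ⊆
        B (nab (Φ.restrict N₁ h₁ hs₁) E) ∪ B (nab (Φ.restrict N₂ h₂ hs₂) E)

/-- ES fusion operator: (ESF1)–(ESF8). -/
def Fusion [LinearOrder S] (B : ℰ → Set W) (nab : Profile S ℰ → ℰ → ℰ) : Prop :=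
  BasicFusion B nab ∧ ESF5 B nab ∧ ESF6 B nab ∧ ESF7 B nab ∧ ESF8 B nab

/-- ES quasifusion operator: (ESF1)–(ESF7) and (ESF8W). -/
def Quasifusion [LinearOrder S] (B : ℰ → Set W) (nab : Profile S ℰ → ℰ → ℰ) : Prop :=
  BasicFusion B nab ∧ ESF5 B nab ∧ ESF6 B nab ∧ ESF7 B nab ∧ ESF8W B nab

/-- (ESF-SD), Standard Domain. -/
def ESFSD (B : ℰ → Set W) (nab : Profile S ℰ → ℰ → ℰ) : Prop :=
  ∀ (i : S) (w w' w'' : W), w ≠ w' → w ≠ w'' → w' ≠ w'' →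
  ∀ (E₁ E₂ : ℰ), B E₁ = {w, w'} → B E₂ = {w', w''} →
    (∃ Ei : ℰ, B (nab (Profile.single i Ei) E₁) = {w, w'} ∧
               B (nab (Profile.single i Ei) E₂) = {w', w''}) ∧
    (∃ Ei : ℰ, B (nab (Profile.single i Ei) E₁) = {w, w'} ∧
               B (nab (Profile.single i Ei) E₂) = {w'}) ∧
    (∃ Ei : ℰ, B (nab (Profile.single i Ei) E₁) = {w} ∧
               B (nab (Profile.single i Ei) E₂) = {w', w''}) ∧
    (∃ Ei : ℰ, B (nab (Profile.single i Ei) E₁) = {w} ∧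
               B (nab (Profile.single i Ei) E₂) = {w'})

/-- (ESF-U), Unanimity. -/
def ESFU (B : ℰ → Set W) (nab : Profile S ℰ → ℰ → ℰ) : Prop :=
  ∀ (Φ : Profile S ℰ), (∀ i j : {x // x ∈ Φ.soc}, Φ.val i = Φ.val j) →
    ∀ (E : ℰ) (i : {x // x ∈ Φ.soc}),
      B (nab Φ E) = B (nab (Profile.single i.1 (Φ.val i)) E)

/-- (ESF-P), Pareto. -/
def ESFP (B : ℰ → Set W) (nab : Profile S ℰ → ℰ → ℰ) : Prop :=
  ∀ (Φ : Profile S ℰ) (E E' : ℰ),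
    (⋂ i : {x // x ∈ Φ.soc}, B (nab (Profile.single i.1 (Φ.val i)) E)).Nonempty →
    (∀ i : {x // x ∈ Φ.soc}, B (nab (Profile.single i.1 (Φ.val i)) E) ∩ B E' = ∅) →
    B (nab Φ E) ∩ B E' = ∅

/-- (ESF-I), Independence. -/
def ESFI (B : ℰ → Set W) (nab : Profile S ℰ → ℰ → ℰ) : Prop :=
  ∀ (N : Finset S) (hN : N.Nonempty) (f g : {x // x ∈ N} → ℰ) (E : ℰ),
    (∀ E' : ℰ, B E' ⊆ B E → ∀ j : {x // x ∈ N},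
      B (nab (Profile.single j.1 (f j)) E') = B (nab (Profile.single j.1 (g j)) E')) →
    B (nab ⟨N, hN, f⟩ E) = B (nab ⟨N, hN, g⟩ E)

/-- (ESF-D), Dictator. -/
def ESFD (B : ℰ → Set W) (nab : Profile S ℰ → ℰ → ℰ) : Prop :=
  ∀ (N : Finset S) (hN : N.Nonempty), ∃ d : {x // x ∈ N},
    ∀ (f : {x // x ∈ N} → ℰ) (E : ℰ),
      B (nab ⟨N, hN, f⟩ E) ⊆ B (nab (Profile.single d.1 (f d)) E)

/-- The maximal elements of `C` with respect to the total preorder `R`. -/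
def MaxSet (C : Set W) (R : W → W → Prop) : Set W :=
  {w ∈ C | ∀ w' ∈ C, R w w'}

/-- The strict part of a total preorder. -/
def StrictRel (R : W → W → Prop) (a b : W) : Prop := R a b ∧ ¬ R b a

/-- An assignment: each profile is mapped to a total preorder over valuations. -/
def IsAssignment (f : Profile S ℰ → W → W → Prop) : Prop :=
  ∀ Φ : Profile S ℰ, (∀ a b : W, f Φ a b ∨ f Φ b a) ∧
    (∀ a b c : W, f Φ a b → f Φ b c → f Φ a c)

/-- A basic assignment: an assignment sending equivalent profiles to equal preorders. -/
def IsBasicAssignment [LinearOrder S] (f : Profile S ℰ → W → W → Prop) : Prop :=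
  IsAssignment f ∧ ∀ Φ Ψ : Profile S ℰ, Profile.Equiv Φ Ψ → f Φ = f Ψ

/-- The assignment `f` represents the operator `nab`. -/
def Represents (B : ℰ → Set W) (nab : Profile S ℰ → ℰ → ℰ)
    (f : Profile S ℰ → W → W → Prop) : Prop :=
  ∀ (Φ : Profile S ℰ) (E : ℰ), B (nab Φ E) = MaxSet (B E) (f Φ)

/-- Property 1. -/
def Prop1 (f : Profile S ℰ → W → W → Prop) : Prop :=
  ∀ (j k : S) (Ej Ek : ℰ), Ej ≠ Ek →
    f (Profile.single j Ej) ≠ f (Profile.single k Ek)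

/-- Property 2. -/
def Prop2 (B : ℰ → Set W) (f : Profile S ℰ → W → W → Prop) : Prop :=
  ∀ Φ : Profile S ℰ, (⋂ i : {x // x ∈ Φ.soc}, B (Φ.val i)).Nonempty →
    (⋂ i : {x // x ∈ Φ.soc}, B (Φ.val i)) = MaxSet Set.univ (f Φ)

/-- Property 3. -/
def Prop3 [DecidableEq S] (f : Profile S ℰ → W → W → Prop) : Prop :=
  ∀ (Φ : Profile S ℰ) (N₁ N₂ : Finset S) (h₁ : N₁.Nonempty) (h₂ : N₂.Nonempty)
    (hs₁ : N₁ ⊆ Φ.soc) (hs₂ : N₂ ⊆ Φ.soc),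
    Disjoint N₁ N₂ → N₁ ∪ N₂ = Φ.soc → ∀ w w' : W,
      f (Φ.restrict N₁ h₁ hs₁) w w' → f (Φ.restrict N₂ h₂ hs₂) w w' → f Φ w w'

/-- Property 4. -/
def Prop4 [DecidableEq S] (f : Profile S ℰ → W → W → Prop) : Prop :=
  ∀ (Φ : Profile S ℰ) (N₁ N₂ : Finset S) (h₁ : N₁.Nonempty) (h₂ : N₂.Nonempty)
    (hs₁ : N₁ ⊆ Φ.soc) (hs₂ : N₂ ⊆ Φ.soc),
    Disjoint N₁ N₂ → N₁ ∪ N₂ = Φ.soc → ∀ w w' : W,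
      f (Φ.restrict N₁ h₁ hs₁) w w' → StrictRel (f (Φ.restrict N₂ h₂ hs₂)) w w' →
        StrictRel (f Φ) w w'

/-- Property 4′. -/
def Prop4' [DecidableEq S] (f : Profile S ℰ → W → W → Prop) : Prop :=
  ∀ (Φ : Profile S ℰ) (N₁ N₂ : Finset S) (h₁ : N₁.Nonempty) (h₂ : N₂.Nonempty)
    (hs₁ : N₁ ⊆ Φ.soc) (hs₂ : N₂ ⊆ Φ.soc),
    Disjoint N₁ N₂ → N₁ ∪ N₂ = Φ.soc → ∀ w w' : W,
      StrictRel (f (Φ.restrict N₁ h₁ hs₁)) w w' →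
      StrictRel (f (Φ.restrict N₂ h₂ hs₂)) w w' →
        StrictRel (f Φ) w w'

/-- The Maximality Condition. -/
def Maximality (B : ℰ → Set W) (f : Profile S ℰ → W → W → Prop) : Prop :=
  ∀ (i : S) (E : ℰ), B E = MaxSet Set.univ (f (Profile.single i E))

/-- Faithful assignment: basic + Properties 1–4. -/
def IsFaithfulAssignment [LinearOrder S] (B : ℰ → Set W)
    (f : Profile S ℰ → W → W → Prop) : Prop :=
  IsBasicAssignment f ∧ Prop1 f ∧ Prop2 B f ∧ Prop3 f ∧ Prop4 f

/-- Quasifaithful assignment: basic + Properties 1–3 and 4′. -/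
def IsQuasifaithfulAssignment [LinearOrder S] (B : ℰ → Set W)
    (f : Profile S ℰ → W → W → Prop) : Prop :=
  IsBasicAssignment f ∧ Prop1 f ∧ Prop2 B f ∧ Prop3 f ∧ Prop4' f

/-- Property (u). -/
def PropU (f : Profile S ℰ → W → W → Prop) : Prop :=
  ∀ (Φ : Profile S ℰ), (∀ i j : {x // x ∈ Φ.soc}, Φ.val i = Φ.val j) →
    ∀ i : {x // x ∈ Φ.soc}, f Φ = f (Profile.single i.1 (Φ.val i))

/-- Property (p). -/
def PropP (f : Profile S ℰ → W → W → Prop) : Prop :=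
  ∀ (Φ : Profile S ℰ) (w w' : W),
    (∀ i : {x // x ∈ Φ.soc}, StrictRel (f (Profile.single i.1 (Φ.val i))) w w') →
    StrictRel (f Φ) w w'

/-- Two relations coincide on the pair `{w, w'}`. -/
def SameOnPair (R R' : W → W → Prop) (w w' : W) : Prop :=
  (R w w' ↔ R' w w') ∧ (R w' w ↔ R' w' w)

/-- Property (ind). -/
def PropInd (f : Profile S ℰ → W → W → Prop) : Prop :=
  ∀ (N : Finset S) (hN : N.Nonempty) (g g' : {x // x ∈ N} → ℰ) (w w' : W),
    (∀ i : {x // x ∈ N},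
      SameOnPair (f (Profile.single i.1 (g i))) (f (Profile.single i.1 (g' i))) w w') →
    SameOnPair (f ⟨N, hN, g⟩) (f ⟨N, hN, g'⟩) w w'

/-- Property (d). -/
def PropD (f : Profile S ℰ → W → W → Prop) : Prop :=
  ∀ (N : Finset S) (hN : N.Nonempty), ∃ d : {x // x ∈ N},
    ∀ (g : {x // x ∈ N} → ℰ) (w w' : W),
      StrictRel (f (Profile.single d.1 (g d))) w w' → StrictRel (f ⟨N, hN, g⟩) w w'

/-- `D` is a locally decisive `N`-coalition for `E` against `E'`. -/
def LocallyDecisiveFor (B : ℰ → Set W) (nab : Profile S ℰ → ℰ → ℰ)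
    (N : Finset S) (hN : N.Nonempty) (D : Finset S) (hD : D ⊆ N) (E E' : ℰ) : Prop :=
  ∀ f : {x // x ∈ N} → ℰ,
    (∀ i : {x // x ∈ D}, B (nab (Profile.single i.1 (f ⟨i.1, hD i.2⟩)) E) ∩ B E' = ∅) →
    (∀ j : {x // x ∈ N}, j.1 ∉ D → B (nab (Profile.single j.1 (f j)) E) = B E') →
    (⋂ i : {x // x ∈ D}, B (nab (Profile.single i.1 (f ⟨i.1, hD i.2⟩)) E)).Nonempty →
    B (nab ⟨N, hN, f⟩ E) ∩ B E' = ∅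

/-- `D` is a decisive `N`-coalition for `E` against `E'`. -/
def DecisiveFor (B : ℰ → Set W) (nab : Profile S ℰ → ℰ → ℰ)
    (N : Finset S) (hN : N.Nonempty) (D : Finset S) (hD : D ⊆ N) (E E' : ℰ) : Prop :=
  ∀ f : {x // x ∈ N} → ℰ,
    (∀ i : {x // x ∈ D}, B (nab (Profile.single i.1 (f ⟨i.1, hD i.2⟩)) E) ∩ B E' = ∅) →
    (⋂ i : {x // x ∈ D}, B (nab (Profile.single i.1 (f ⟨i.1, hD i.2⟩)) E)).Nonempty →
    B (nab ⟨N, hN, f⟩ E) ∩ B E' = ∅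

/-- `D` is a decisive `N`-coalition. -/
def DecisiveCoalition (B : ℰ → Set W) (nab : Profile S ℰ → ℰ → ℰ)
    (N : Finset S) (hN : N.Nonempty) (D : Finset S) (hD : D ⊆ N) : Prop :=
  ∀ E E' : ℰ, DecisiveFor B nab N hN D hD E E'

end BeliefMerging

namespace BeliefMerging

section Arrow

variable {ι ℰ W : Type}

/-- The hypotheses of Arrow's theorem, on a domain in which every individual ordering of
a triple of alternatives is available: `r i E` is the preference of individual `i` in state
`E`, and `F f` the social preference for the profile `f`. -/
structure ArrowFrame (r : ι → ℰ → W → W → Prop) (F : (ι → ℰ) → W → W → Prop) : Prop where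
  total : ∀ f a b, F f a b ∨ F f b a
  trans : ∀ f a b c, F f a b → F f b c → F f a c
  pareto : ∀ f a b, (∀ i, StrictRel (r i (f i)) a b) → StrictRel (F f) a b
  indep : ∀ f g a b, (∀ i, SameOnPair (r i (f i)) (r i (g i)) a b) →
    SameOnPair (F f) (F g) a b
  chain : ∀ i a b c, a ≠ b → a ≠ c → b ≠ c →
    ∃ E, StrictRel (r i E) a b ∧ StrictRel (r i E) b c ∧ StrictRel (r i E) a c
  top : ∀ i a b c E₀, a ≠ b → a ≠ c → b ≠ c →
    ∃ E, StrictRel (r i E) b a ∧ StrictRel (r i E) b c ∧ SameOnPair (r i E) (r i E₀) a c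
  bot : ∀ i a b c E₀, a ≠ b → a ≠ c → b ≠ c →
    ∃ E, StrictRel (r i E) a b ∧ StrictRel (r i E) c b ∧ SameOnPair (r i E) (r i E₀) a c

/-- The coalition `G` imposes `a` over `b` when all other individuals have the opposite
preference. -/
def AlmostDecisive (r : ι → ℰ → W → W → Prop) (F : (ι → ℰ) → W → W → Prop)
    (G : Set ι) (a b : W) : Prop :=
  ∀ f, (∀ i ∈ G, StrictRel (r i (f i)) a b) → (∀ i ∉ G, StrictRel (r i (f i)) b a) →
    StrictRel (F f) a b

/-- The coalition `G` imposes `a` over `b`. -/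
def Decisive (r : ι → ℰ → W → W → Prop) (F : (ι → ℰ) → W → W → Prop)
    (G : Set ι) (a b : W) : Prop :=
  ∀ f, (∀ i ∈ G, StrictRel (r i (f i)) a b) → StrictRel (F f) a b

theorem StrictRel.sameOnPair {R R' : W → W → Prop} {a b : W} (h : StrictRel R a b)
    (h' : StrictRel R' a b) : SameOnPair R R' a b :=
  ⟨iff_of_true h.1 h'.1, iff_of_false h.2 h'.2⟩

theorem StrictRel.sameOnPair_symm {R R' : W → W → Prop} {a b : W} (h : StrictRel R b a)
    (h' : StrictRel R' b a) : SameOnPair R R' a b :=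
  ⟨iff_of_false h.2 h'.2, iff_of_true h.1 h'.1⟩

theorem SameOnPair.strictRel_iff {R R' : W → W → Prop} {a b : W} (h : SameOnPair R R' a b) :
    StrictRel R a b ↔ StrictRel R' a b :=
  and_congr h.1 (not_congr h.2)

theorem StrictRel.trans_of_trans {R : W → W → Prop} (hR : ∀ a b c, R a b → R b c → R a c)
    {a b c : W} (h : StrictRel R a b) (h' : StrictRel R b c) : StrictRel R a c :=
  ⟨hR _ _ _ h.1 h'.1, fun hc => h.2 (hR _ _ _ h'.1 hc)⟩

variable {r : ι → ℰ → W → W → Prop} {F : (ι → ℰ) → W → W → Prop}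

theorem Decisive.almostDecisive {G : Set ι} {a b : W} (h : Decisive r F G a b) :
    AlmostDecisive r F G a b :=
  fun f hf _ => h f hf

namespace ArrowFrame

theorem almostDecisive_of_witness (A : ArrowFrame r F) {G : Set ι} {a b : W} (f : ι → ℰ)
    (hG : ∀ i ∈ G, StrictRel (r i (f i)) a b) (hG' : ∀ i ∉ G, StrictRel (r i (f i)) b a)
    (hf : StrictRel (F f) a b) : AlmostDecisive r F G a b := by
  intro g hg hg'
  refine (A.indep f g a b fun i => ?_).strictRel_iff.1 hf
  by_cases hi : i ∈ G
  · exact (hG i hi).sameOnPair (hg i hi)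
  · exact (hG' i hi).sameOnPair_symm (hg' i hi)

theorem decisive_right (A : ArrowFrame r F) {G : Set ι} {a b c : W} (hab : a ≠ b)
    (hac : a ≠ c) (hbc : b ≠ c) (h : AlmostDecisive r F G a b) : Decisive r F G a c := by
  intro f hf
  have key : ∀ i, ∃ E, (i ∈ G → StrictRel (r i E) a b) ∧ (i ∉ G → StrictRel (r i E) b a) ∧
      StrictRel (r i E) b c ∧ SameOnPair (r i E) (r i (f i)) a c := by
    intro i
    by_cases hi : i ∈ G
    · obtain ⟨E, h₁, h₂, h₃⟩ := A.chain i a b c hab hac hbc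
      exact ⟨E, fun _ => h₁, fun h' => absurd hi h', h₂, h₃.sameOnPair (hf i hi)⟩
    · obtain ⟨E, h₁, h₂, h₃⟩ := A.top i a b c (f i) hab hac hbc
      exact ⟨E, fun h' => absurd h' hi, fun _ => h₁, h₂, h₃⟩
  choose g hg₁ hg₂ hg₃ hg₄ using key
  exact (A.indep g f a c hg₄).strictRel_iff.1
    ((h g hg₁ hg₂).trans_of_trans (A.trans g) (A.pareto g b c hg₃))

theorem decisive_left (A : ArrowFrame r F) {G : Set ι} {a b c : W} (hab : a ≠ b)
    (hac : a ≠ c) (hbc : b ≠ c) (h : AlmostDecisive r F G a b) : Decisive r F G c b := by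
  intro f hf
  have key : ∀ i, ∃ E, (i ∈ G → StrictRel (r i E) a b) ∧ (i ∉ G → StrictRel (r i E) b a) ∧
      StrictRel (r i E) c a ∧ SameOnPair (r i E) (r i (f i)) c b := by
    intro i
    by_cases hi : i ∈ G
    · obtain ⟨E, h₁, h₂, h₃⟩ := A.chain i c a b hac.symm hbc.symm hab
      exact ⟨E, fun _ => h₂, fun h' => absurd hi h', h₁, h₃.sameOnPair (hf i hi)⟩
    · obtain ⟨E, h₁, h₂, h₃⟩ := A.bot i c a b (f i) hac.symm hbc.symm hab
      exact ⟨E, fun h' => absurd h' hi, fun _ => h₂, h₁, h₃⟩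
  choose g hg₁ hg₂ hg₃ hg₄ using key
  exact (A.indep g f c b hg₄).strictRel_iff.1
    ((A.pareto g c a hg₃).trans_of_trans (A.trans g) (h g hg₁ hg₂))

/-- Field expansion: almost decisiveness over one pair gives decisiveness over all pairs. -/
theorem decisive_of_almostDecisive (A : ArrowFrame r F)
    (hthird : ∀ a b : W, ∃ c, c ≠ a ∧ c ≠ b) {G : Set ι} {a b : W} (hab : a ≠ b)
    (h : AlmostDecisive r F G a b) {x y : W} (hxy : x ≠ y) : Decisive r F G x y := by
  have right : ∀ {p q z : W}, p ≠ q → p ≠ z → Decisive r F G p q → Decisive r F G p z := by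
    intro p q z hpq hpz hd
    by_cases hqz : q = z
    · exact hqz ▸ hd
    · exact A.decisive_right hpq hpz hqz hd.almostDecisive
  have left : ∀ {p q z : W}, p ≠ q → z ≠ q → Decisive r F G p q → Decisive r F G z q := by
    intro p q z hpq hzq hd
    by_cases hpz : p = z
    · exact hpz ▸ hd
    · exact A.decisive_left hpq hpz hzq.symm hd.almostDecisive
  obtain ⟨d, hda, hdb⟩ := hthird a b
  obtain ⟨c, hca, hcx⟩ := hthird a x
  have had := A.decisive_right hab hda.symm hdb.symm h
  exact right hcx.symm hxy (left hca.symm hcx.symm (right hda.symm hca.symm had))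

/-- Group contraction: if the union of two disjoint coalitions is decisive, so is one of
them. -/
theorem decisive_or_decisive (A : ArrowFrame r F) [Nonempty W]
    (hthird : ∀ a b : W, ∃ c, c ≠ a ∧ c ≠ b) {G₁ G₂ : Set ι} (hdisj : Disjoint G₁ G₂)
    (h : ∀ x y, x ≠ y → Decisive r F (G₁ ∪ G₂) x y) :
    (∀ x y, x ≠ y → Decisive r F G₁ x y) ∨ (∀ x y, x ≠ y → Decisive r F G₂ x y) := by
  obtain ⟨a⟩ := ‹Nonempty W›
  obtain ⟨b, hba, -⟩ := hthird a a
  obtain ⟨c, hca, hcb⟩ := hthird a b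
  have key : ∀ i, ∃ E,
      (i ∈ G₁ → StrictRel (r i E) a b ∧ StrictRel (r i E) b c ∧ StrictRel (r i E) a c) ∧
      (i ∈ G₂ → StrictRel (r i E) b c ∧ StrictRel (r i E) c a ∧ StrictRel (r i E) b a) ∧
      (i ∉ G₁ → i ∉ G₂ →
        StrictRel (r i E) c a ∧ StrictRel (r i E) a b ∧ StrictRel (r i E) c b) := by
    intro i
    by_cases h₁ : i ∈ G₁
    · have h₂ : i ∉ G₂ := Set.disjoint_left.1 hdisj h₁
      obtain ⟨E, hE⟩ := A.chain i a b c hba.symm hca.symm hcb.symm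
      exact ⟨E, fun _ => hE, fun h' => absurd h' h₂, fun h' => absurd h₁ h'⟩
    · by_cases h₂ : i ∈ G₂
      · obtain ⟨E, hE⟩ := A.chain i b c a hcb.symm hba hca
        exact ⟨E, fun h' => absurd h' h₁, fun _ => hE, fun _ h' => absurd h₂ h'⟩
      · obtain ⟨E, hE⟩ := A.chain i c a b hca hcb hba.symm
        exact ⟨E, fun h' => absurd h' h₁, fun h' => absurd h' h₂, fun _ _ => hE⟩
  choose f hf₁ hf₂ hf₃ using key
  have hbc : StrictRel (F f) b c :=
    h b c hcb.symm f fun i hi => hi.elim (fun h' => (hf₁ i h').2.1) fun h' => (hf₂ i h').1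
  by_cases hac : F f c a
  · right
    intro x y hxy
    refine A.decisive_of_almostDecisive hthird hba (A.almostDecisive_of_witness f
      (fun i hi => (hf₂ i hi).2.2) (fun i hi => ?_) ?_) hxy
    · by_cases h₁ : i ∈ G₁
      · exact (hf₁ i h₁).1
      · exact (hf₃ i h₁ hi).2.1
    · exact ⟨A.trans f _ _ _ hbc.1 hac, fun hab => hbc.2 (A.trans f _ _ _ hac hab)⟩
  · left
    intro x y hxy
    refine A.decisive_of_almostDecisive hthird hca.symm (A.almostDecisive_of_witness f
      (fun i hi => (hf₁ i hi).2.2) (fun i hi => ?_)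
      ⟨(A.total f a c).resolve_right hac, hac⟩) hxy
    by_cases h₂ : i ∈ G₂
    · exact (hf₂ i h₂).2.1
    · exact (hf₃ i hi h₂).1

/-- Arrow's theorem. -/
theorem exists_dictator (A : ArrowFrame r F) [Fintype ι] [Nonempty W]
    (hthird : ∀ a b : W, ∃ c, c ≠ a ∧ c ≠ b) :
    ∃ d : ι, ∀ x y, x ≠ y → Decisive r F {d} x y := by
  classical
  suffices H : ∀ G : Finset ι, (∀ x y, x ≠ y → Decisive r F (G : Set ι) x y) →
      ∃ d : ι, ∀ x y, x ≠ y → Decisive r F {d} x y from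
    H Finset.univ fun x y _ f hf => A.pareto f x y fun i => hf i (by simp)
  intro G
  induction G using Finset.induction_on with
  | empty =>
    intro h
    obtain ⟨a⟩ := ‹Nonempty W›
    obtain ⟨b, hba, -⟩ := hthird a a
    obtain ⟨c, hca, hcb⟩ := hthird a b
    choose f hf using fun i => A.chain i a b c hba.symm hca.symm hcb.symm
    exact absurd (h b a hba f (by simp)).1 (A.pareto f a b fun i => (hf i).1).2
  | insert i G hi ih =>
    intro h
    rw [Finset.coe_insert, Set.insert_eq] at h
    exact (A.decisive_or_decisive hthird (by simpa using hi) h).elim (fun h' => ⟨i, h'⟩) ih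

end ArrowFrame

end Arrow

section PairRel

variable {S ℰ W : Type}

/-- The relation revealed by the choices of `nab` from two-element sets. -/
def PairRel (B : ℰ → Set W) (nab : Profile S ℰ → ℰ → ℰ) (Φ : Profile S ℰ) (a b : W) : Prop :=
  ∀ E, B E = {a, b} → a ∈ B (nab Φ E)

theorem Profile.eq_single {N : Finset S} {hN : N.Nonempty} {f : {x // x ∈ N} → ℰ} {j : S}
    (h : N = {j}) (hj : j ∈ N) :
    (⟨N, hN, f⟩ : Profile S ℰ) = Profile.single j (f ⟨j, hj⟩) := by
  subst h
  refine congrArg (Profile.mk {j} hN) (funext fun ⟨x, hx⟩ => ?_)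
  obtain rfl := Finset.mem_singleton.1 hx
  rfl

variable [LinearOrder S] {B : ℰ → Set W} {nab : Profile S ℰ → ℰ → ℰ}

theorem BasicFusion.eq_of_eq (hbf : BasicFusion B nab) (Φ : Profile S ℰ) {E E' : ℰ}
    (h : B E = B E') : B (nab Φ E) = B (nab Φ E') :=
  hbf.2.1 Φ Φ E E' ⟨rfl, fun _ => rfl⟩ h

theorem BasicFusion.pairRel_iff (hbf : BasicFusion B nab) {Φ : Profile S ℰ} {E : ℰ} {a b : W}
    (hE : B E = {a, b}) : PairRel B nab Φ a b ↔ a ∈ B (nab Φ E) :=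
  ⟨fun h => h E hE, fun h _ hE' => hbf.eq_of_eq Φ (hE.trans hE'.symm) ▸ h⟩

theorem BasicFusion.pairRel_of_mem (hbf : BasicFusion B nab) {Φ : Profile S ℰ} {E : ℰ}
    {a b : W} (ha : a ∈ B (nab Φ E)) (hb : b ∈ B E) : PairRel B nab Φ a b := by
  intro E₂ h₂
  refine hbf.2.2.1 Φ E₂ E E₂ ?_ ⟨ha, by simp [h₂]⟩
  rw [eq_comm, Set.inter_eq_right, h₂]
  exact Set.insert_subset (hbf.1 Φ E ha) (Set.singleton_subset_iff.2 hb)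

variable (hsurj : ∀ A : Set W, A.Nonempty → ∃ E : ℰ, B E = A) (hbf : BasicFusion B nab)
include hsurj hbf

theorem BasicFusion.mem_of_pairRel {Φ : Profile S ℰ} {E : ℰ} {a b : W}
    (hb : b ∈ B (nab Φ E)) (ha : a ∈ B E) (h : PairRel B nab Φ a b) : a ∈ B (nab Φ E) := by
  obtain ⟨E₂, h₂⟩ := hsurj {a, b} ⟨a, by simp⟩
  refine (hbf.2.2.2 Φ E₂ E E₂ ?_ ⟨b, hb, by simp [h₂]⟩ (h E₂ h₂)).1
  rw [eq_comm, Set.inter_eq_right, h₂]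
  exact Set.insert_subset ha (Set.singleton_subset_iff.2 (hbf.1 Φ E hb))

variable (hB : ∀ E : ℰ, (B E).Nonempty)
include hB

theorem BasicFusion.represents : Represents B nab (PairRel B nab) := by
  intro Φ E
  ext a
  refine ⟨fun ha => ⟨hbf.1 Φ E ha, fun b hb => hbf.pairRel_of_mem ha hb⟩, ?_⟩
  rintro ⟨ha, h⟩
  obtain ⟨x, hx⟩ := hB (nab Φ E)
  exact hbf.mem_of_pairRel hsurj hx ha (h x (hbf.1 Φ E hx))

theorem BasicFusion.pairRel_isAssignment :
    IsAssignment (PairRel B nab : Profile S ℰ → W → W → Prop) := by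
  refine fun Φ => ⟨fun a b => ?_, fun a b c hab hbc => ?_⟩
  · obtain ⟨E, hE⟩ := hsurj {a, b} ⟨a, by simp⟩
    obtain ⟨x, hx⟩ := hB (nab Φ E)
    have hx' := hbf.1 Φ E hx
    rw [hE] at hx'
    rcases hx' with rfl | rfl
    · exact Or.inl (hbf.pairRel_of_mem hx (by simp [hE]))
    · exact Or.inr (hbf.pairRel_of_mem hx (by simp [hE]))
  · obtain ⟨E, hE⟩ := hsurj {a, b, c} ⟨a, by simp⟩
    have haE : a ∈ B E := by simp [hE]
    have hbE : b ∈ B E := by simp [hE]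
    obtain ⟨x, hx⟩ := hB (nab Φ E)
    have hx' := hbf.1 Φ E hx
    rw [hE] at hx'
    have ha : a ∈ B (nab Φ E) := by
      rcases hx' with rfl | rfl | rfl
      · exact hx
      · exact hbf.mem_of_pairRel hsurj hx haE hab
      · exact hbf.mem_of_pairRel hsurj (hbf.mem_of_pairRel hsurj hx hbE hbc) haE hab
    exact hbf.pairRel_of_mem ha (by simp [hE])

theorem BasicFusion.prop4' (h8w : ESF8W B nab) : Prop4' (PairRel B nab) := by
  intro Φ N₁ N₂ h₁ h₂ hs₁ hs₂ hdisj hunion a b hs hs'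
  obtain ⟨E, hE⟩ := hsurj {a, b} ⟨a, by simp⟩
  have hE' : B E = {b, a} := hE.trans (Set.pair_comm a b)
  have hba : ¬ PairRel B nab Φ b a := by
    intro h
    rcases h8w Φ N₁ N₂ h₁ h₂ hs₁ hs₂ hdisj hunion E ⟨a, hs.1 E hE, hs'.1 E hE⟩ (h E hE')
      with h | h
    · exact hs.2 ((hbf.pairRel_iff hE').2 h)
    · exact hs'.2 ((hbf.pairRel_iff hE').2 h)
  exact ⟨((hbf.pairRel_isAssignment hsurj hB Φ).1 a b).resolve_right hba, hba⟩

omit hsurj hbf hB in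
theorem Prop4'.propP {f : Profile S ℰ → W → W → Prop} (h4 : Prop4' f) : PropP f := by
  rintro ⟨N, hN, g⟩ a b
  induction N using Finset.induction_on with
  | empty => exact absurd hN (by simp)
  | insert j N hj ih =>
    intro h
    rcases N.eq_empty_or_nonempty with hN' | hN'
    · subst hN'
      rw [Profile.eq_single (N := insert j ∅) (j := j) rfl (by simp)]
      exact h ⟨j, _⟩
    · refine h4 ⟨insert j N, hN, g⟩ {j} N (Finset.singleton_nonempty j) hN' (by simp)
        (Finset.subset_insert j N) (by simpa using hj) (Finset.insert_eq j N).symm a b ?_ ?_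
      · rw [Profile.restrict, Profile.eq_single (j := j) rfl (by simp)]
        exact h ⟨j, _⟩
      · exact ih hN' _ fun i => h ⟨i.1, Finset.mem_insert_of_mem i.2⟩

theorem BasicFusion.propInd (hi : ESFI B nab) : PropInd (PairRel B nab) := by
  intro N hN f g a b h
  obtain ⟨E, hE⟩ := hsurj {a, b} ⟨a, by simp⟩
  have hE' : B E = {b, a} := hE.trans (Set.pair_comm a b)
  have refl : ∀ (Φ : Profile S ℰ) (x : W), PairRel B nab Φ x x := fun Φ x =>
    ((hbf.pairRel_isAssignment hsurj hB Φ).1 x x).elim id id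
  have heq : B (nab ⟨N, hN, f⟩ E) = B (nab ⟨N, hN, g⟩ E) := by
    refine hi N hN f g E fun E' hE'' j => ?_
    rw [hbf.represents hsurj hB, hbf.represents hsurj hB]
    ext x
    refine and_congr_right fun hx => forall₂_congr fun y hy => ?_
    have hx' := hE'' hx
    have hy' := hE'' hy
    rw [hE] at hx' hy'
    rcases hx' with rfl | rfl <;> rcases hy' with rfl | rfl
    · exact iff_of_true (refl _ _) (refl _ _)
    · exact (h j).1
    · exact (h j).2
    · exact iff_of_true (refl _ _) (refl _ _)
  exact ⟨by rw [hbf.pairRel_iff hE, hbf.pairRel_iff hE, heq],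
    by rw [hbf.pairRel_iff hE', hbf.pairRel_iff hE', heq]⟩

omit hsurj hB in
theorem BasicFusion.strictRel_of_eq_singleton {Φ : Profile S ℰ} {E : ℰ} {a b : W}
    (hab : a ≠ b) (hE : B E = {a, b}) (h : B (nab Φ E) = {a}) :
    StrictRel (PairRel B nab Φ) a b := by
  rw [StrictRel, hbf.pairRel_iff hE, hbf.pairRel_iff (hE.trans (Set.pair_comm a b)), h]
  exact ⟨rfl, fun h' => hab h'.symm⟩

omit hsurj hB in
theorem BasicFusion.pairRel_of_eq_pair {Φ : Profile S ℰ} {E : ℰ} {a b : W}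
    (hE : B E = {a, b}) (h : B (nab Φ E) = {a, b}) :
    PairRel B nab Φ a b ∧ PairRel B nab Φ b a := by
  rw [hbf.pairRel_iff hE, hbf.pairRel_iff (hE.trans (Set.pair_comm a b)), h]
  simp

omit hB in
theorem BasicFusion.exists_orderings (hsd : ESFSD B nab) (i : S) {a b c : W}
    (hab : a ≠ b) (hac : a ≠ c) (hbc : b ≠ c) :
    (∃ E, (PairRel B nab (Profile.single i E) a b ∧ PairRel B nab (Profile.single i E) b a) ∧
      StrictRel (PairRel B nab (Profile.single i E)) b c) ∧
    (∃ E, StrictRel (PairRel B nab (Profile.single i E)) a b ∧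
      PairRel B nab (Profile.single i E) b c ∧ PairRel B nab (Profile.single i E) c b) ∧
    (∃ E, StrictRel (PairRel B nab (Profile.single i E)) a b ∧
      StrictRel (PairRel B nab (Profile.single i E)) b c) := by
  obtain ⟨E₁, h₁⟩ := hsurj {a, b} ⟨a, by simp⟩
  obtain ⟨E₂, h₂⟩ := hsurj {b, c} ⟨b, by simp⟩
  obtain ⟨-, ⟨E, hE, hE'⟩, ⟨E', hF, hF'⟩, ⟨E'', hG, hG'⟩⟩ :=
    hsd i a b c hab hac hbc E₁ E₂ h₁ h₂
  exact ⟨⟨E, hbf.pairRel_of_eq_pair h₁ hE, hbf.strictRel_of_eq_singleton hbc h₂ hE'⟩,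
    ⟨E', hbf.strictRel_of_eq_singleton hab h₁ hF, hbf.pairRel_of_eq_pair h₂ hF'⟩,
    ⟨E'', hbf.strictRel_of_eq_singleton hab h₁ hG, hbf.strictRel_of_eq_singleton hbc h₂ hG'⟩⟩

theorem BasicFusion.arrowFrame (hsd : ESFSD B nab) (h8w : ESF8W B nab) (hi : ESFI B nab)
    (N : Finset S) (hN : N.Nonempty) :
    ArrowFrame (fun (i : {x // x ∈ N}) E => PairRel B nab (Profile.single i.1 E))
      (fun f => PairRel B nab ⟨N, hN, f⟩) where
  total f := (hbf.pairRel_isAssignment hsurj hB _).1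
  trans f := (hbf.pairRel_isAssignment hsurj hB _).2
  pareto f a b h := (hbf.prop4' hsurj hB h8w).propP ⟨N, hN, f⟩ a b h
  indep f g a b h := hbf.propInd hsurj hB hi N hN f g a b h
  chain i a b c hab hac hbc := by
    obtain ⟨-, -, E, h₁, h₂⟩ := hbf.exists_orderings hsurj hsd i.1 hab hac hbc
    exact ⟨E, h₁, h₂, h₁.trans_of_trans (hbf.pairRel_isAssignment hsurj hB _).2 h₂⟩
  top i a b c E₀ hab hac hbc := by
    have tr E := (hbf.pairRel_isAssignment hsurj hB (Profile.single i.1 E)).2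
    by_cases h₁ : PairRel B nab (Profile.single i.1 E₀) a c
    · by_cases h₂ : PairRel B nab (Profile.single i.1 E₀) c a
      · obtain ⟨-, ⟨E, hE, hE'⟩, -⟩ := hbf.exists_orderings hsurj hsd i.1 hab.symm hbc hac
        exact ⟨E, hE, ⟨tr E _ _ _ hE.1 hE'.1, fun h => hE.2 (tr E _ _ _ hE'.1 h)⟩,
          iff_of_true hE'.1 h₁, iff_of_true hE'.2 h₂⟩
      · obtain ⟨-, -, E, hE, hE'⟩ := hbf.exists_orderings hsurj hsd i.1 hab.symm hbc hac
        exact ⟨E, hE, hE.trans_of_trans (tr E) hE', hE'.sameOnPair ⟨h₁, h₂⟩⟩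
    · have h₂ := ((hbf.pairRel_isAssignment hsurj hB _).1 a c).resolve_left h₁
      obtain ⟨-, -, E, hE, hE'⟩ := hbf.exists_orderings hsurj hsd i.1 hbc hab.symm hac.symm
      exact ⟨E, hE.trans_of_trans (tr E) hE', hE, hE'.sameOnPair_symm ⟨h₂, h₁⟩⟩
  bot i a b c E₀ hab hac hbc := by
    have tr E := (hbf.pairRel_isAssignment hsurj hB (Profile.single i.1 E)).2
    by_cases h₁ : PairRel B nab (Profile.single i.1 E₀) a c
    · by_cases h₂ : PairRel B nab (Profile.single i.1 E₀) c a
      · obtain ⟨⟨E, hE, hE'⟩, -⟩ := hbf.exists_orderings hsurj hsd i.1 hac hab hbc.symm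
        exact ⟨E, ⟨tr E _ _ _ hE.1 hE'.1, fun h => hE'.2 (tr E _ _ _ h hE.1)⟩, hE',
          iff_of_true hE.1 h₁, iff_of_true hE.2 h₂⟩
      · obtain ⟨-, -, E, hE, hE'⟩ := hbf.exists_orderings hsurj hsd i.1 hac hab hbc.symm
        exact ⟨E, hE.trans_of_trans (tr E) hE', hE', hE.sameOnPair ⟨h₁, h₂⟩⟩
    · have h₂ := ((hbf.pairRel_isAssignment hsurj hB _).1 a c).resolve_left h₁
      obtain ⟨-, -, E, hE, hE'⟩ := hbf.exists_orderings hsurj hsd i.1 hac.symm hbc.symm hab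
      exact ⟨E, hE', hE.trans_of_trans (tr E) hE', hE.sameOnPair_symm ⟨h₂, h₁⟩⟩

end PairRel

end BeliefMerging

open BeliefMerging in
/-- An ES basic fusion operator satisfying (ESF-SD), (ESF7), (ESF8W) and
(ESF-I) is dictatorial. -/
theorem impossibility_esf7_esf8w
    {S ℰ W : Type} [LinearOrder S] [Nonempty S] [Fintype W] [Nonempty W]
    (hcard : 4 ≤ Fintype.card W)
    (B : ℰ → Set W) (hB : ∀ E : ℰ, (B E).Nonempty)
    (hsurj : ∀ A : Set W, A.Nonempty → ∃ E : ℰ, B E = A)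
    (nab : Profile S ℰ → ℰ → ℰ) (hbf : BasicFusion B nab)
    (hsd : ESFSD B nab) (h7 : ESF7 B nab) (h8w : ESF8W B nab) (hi : ESFI B nab) :
    ESFD B nab := by
  have hthird : ∀ a b : W, ∃ c, c ≠ a ∧ c ≠ b := by
    classical
    intro a b
    obtain ⟨c, hc⟩ := Finset.exists_mem_notMem_of_card_lt_card
      (s := {a, b}) (t := (Finset.univ : Finset W))
      (lt_of_le_of_lt Finset.card_le_two (by rw [Finset.card_univ]; omega))
    exact ⟨c, by simpa using hc⟩
  intro N hN
  obtain ⟨d, hd⟩ := (hbf.arrowFrame hsurj hB hsd h8w hi N hN).exists_dictator hthird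
  refine ⟨d, fun f E w hw => ?_⟩
  by_contra hwd
  obtain ⟨x, hx⟩ := hB (nab (Profile.single d.1 (f d)) E)
  have hwE := hbf.1 _ _ hw
  have hxw : StrictRel (PairRel B nab (Profile.single d.1 (f d))) x w :=
    ⟨hbf.pairRel_of_mem hx hwE, fun h => hwd (hbf.mem_of_pairRel hsurj hx hwE h)⟩
  have hne : x ≠ w := fun h => hwd (h ▸ hx)
  exact (hd x w hne f (by simpa using hxw)).2 (hbf.pairRel_of_mem hw (hbf.1 _ _ hx))
end

section
/- Any ES basic fusion operator that satisfies (ESF-SD), (ESF-U) and (ESF-I) also satisfies (ESF-D). -/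
namespace BeliefMerging

section Arrow

variable {ι ℰ W : Type}

/-- An aggregation rule `F` on a domain of individual preferences with the free triple property,
satisfying the weak Pareto principle and independence of irrelevant alternatives. -/
structure IsArrovian (pref : ι → ℰ → W → W → Prop) (F : (ι → ℰ) → W → W → Prop) : Prop where
  agent_total : ∀ i e a b, pref i e a b ∨ pref i e b a
  total : ∀ f a b, F f a b ∨ F f b a
  trans : ∀ f a b c, F f a b → F f b c → F f a c
  pareto : ∀ f a b, (∀ i, StrictRel (pref i (f i)) a b) → StrictRel (F f) a b
  indep : ∀ f g a b, (∀ i, SameOnPair (pref i (f i)) (pref i (g i)) a b) →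
    SameOnPair (F f) (F g) a b
  exists_strict : ∀ i a b c, a ≠ b → a ≠ c → b ≠ c → ∃ e, StrictRel (pref i e) a b ∧
    StrictRel (pref i e) b c ∧ StrictRel (pref i e) a c
  exists_tie_below : ∀ i a b c, a ≠ b → a ≠ c → b ≠ c → ∃ e, StrictRel (pref i e) a b ∧
    StrictRel (pref i e) a c ∧ pref i e b c ∧ pref i e c b
  exists_tie_above : ∀ i a b c, a ≠ b → a ≠ c → b ≠ c → ∃ e, pref i e a b ∧ pref i e b a ∧
    StrictRel (pref i e) a c ∧ StrictRel (pref i e) b c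

/-- The coalition `D` imposes `a` over `b` whenever all its members strictly prefer `a`. -/
def Imposes (pref : ι → ℰ → W → W → Prop) (F : (ι → ℰ) → W → W → Prop) (D : Finset ι)
    (a b : W) : Prop :=
  ∀ f, (∀ i ∈ D, StrictRel (pref i (f i)) a b) → StrictRel (F f) a b

/-- The coalition `D` imposes `a` over `b` whenever all its members strictly prefer `a` and
everybody else strictly prefers `b`. -/
def ImposesAgainst (pref : ι → ℰ → W → W → Prop) (F : (ι → ℰ) → W → W → Prop) (D : Finset ι)
    (a b : W) : Prop :=
  ∀ f, (∀ i ∈ D, StrictRel (pref i (f i)) a b) → (∀ i ∉ D, StrictRel (pref i (f i)) b a) →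
    StrictRel (F f) a b

theorem Imposes.against {pref : ι → ℰ → W → W → Prop} {F : (ι → ℰ) → W → W → Prop}
    {D : Finset ι} {a b : W} (h : Imposes pref F D a b) : ImposesAgainst pref F D a b :=
  fun f hf _ => h f hf

theorem SameOnPair.swap {R R' : W → W → Prop} {a b : W} (h : SameOnPair R R' a b) :
    SameOnPair R R' b a := ⟨h.2, h.1⟩

theorem SameOnPair.strictRel {R R' : W → W → Prop} {a b : W} (h : SameOnPair R R' a b)
    (hs : StrictRel R a b) : StrictRel R' a b :=
  ⟨h.1.1 hs.1, fun hb => hs.2 (h.2.2 hb)⟩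

namespace IsArrovian

variable {pref : ι → ℰ → W → W → Prop} {F : (ι → ℰ) → W → W → Prop}

theorem strict_trans (hF : IsArrovian pref F) {f : ι → ℰ} {a b c : W}
    (hab : StrictRel (F f) a b) (hbc : StrictRel (F f) b c) : StrictRel (F f) a c :=
  ⟨hF.trans f a b c hab.1 hbc.1, fun hca => hab.2 (hF.trans f b c a hbc.1 hca)⟩

theorem exists_top (hF : IsArrovian pref F) (i : ι) (e : ℰ) {t a b : W} (ha : t ≠ a)
    (hb : t ≠ b) (hab : a ≠ b) : ∃ e', StrictRel (pref i e') t a ∧ StrictRel (pref i e') t b ∧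
      SameOnPair (pref i e') (pref i e) a b := by
  by_cases h₁ : pref i e a b <;> by_cases h₂ : pref i e b a
  · obtain ⟨e', h, h', h'', h'''⟩ := hF.exists_tie_below i t a b ha hb hab
    exact ⟨e', h, h', by simp [SameOnPair, *]⟩
  · obtain ⟨e', h, h', h''⟩ := hF.exists_strict i t a b ha hb hab
    exact ⟨e', h, h'', h'.sameOnPair ⟨h₁, h₂⟩⟩
  · obtain ⟨e', h, h', h''⟩ := hF.exists_strict i t b a hb ha hab.symm
    exact ⟨e', h'', h, (h'.sameOnPair ⟨h₂, h₁⟩).swap⟩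
  · exact ((hF.agent_total i e a b).elim h₁ h₂).elim

theorem exists_bottom (hF : IsArrovian pref F) (i : ι) (e : ℰ) {t a b : W} (ha : a ≠ t)
    (hb : b ≠ t) (hab : a ≠ b) : ∃ e', StrictRel (pref i e') a t ∧ StrictRel (pref i e') b t ∧
      SameOnPair (pref i e') (pref i e) a b := by
  by_cases h₁ : pref i e a b <;> by_cases h₂ : pref i e b a
  · obtain ⟨e', h, h', h'', h'''⟩ := hF.exists_tie_above i a b t hab ha hb
    exact ⟨e', h'', h''', by simp [SameOnPair, *]⟩
  · obtain ⟨e', h, h', h''⟩ := hF.exists_strict i a b t hab ha hb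
    exact ⟨e', h'', h', h.sameOnPair ⟨h₁, h₂⟩⟩
  · obtain ⟨e', h, h', h''⟩ := hF.exists_strict i b a t hab.symm hb ha
    exact ⟨e', h', h'', (h.sameOnPair ⟨h₂, h₁⟩).swap⟩
  · exact ((hF.agent_total i e a b).elim h₁ h₂).elim

theorem imposes_right (hF : IsArrovian pref F) {D : Finset ι} {a b c : W} (hab : a ≠ b)
    (hac : a ≠ c) (hbc : b ≠ c) (h : ImposesAgainst pref F D a b) : Imposes pref F D a c := by
  intro f hf
  have key : ∀ i, ∃ e, (i ∈ D → StrictRel (pref i e) a b) ∧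
      (i ∉ D → StrictRel (pref i e) b a) ∧ StrictRel (pref i e) b c ∧
      SameOnPair (pref i e) (pref i (f i)) a c := by
    intro i
    by_cases hi : i ∈ D
    · obtain ⟨e, h₁, h₂, h₃⟩ := hF.exists_strict i a b c hab hac hbc
      exact ⟨e, fun _ => h₁, fun hn => (hn hi).elim, h₂, h₃.sameOnPair (hf i hi)⟩
    · obtain ⟨e, h₁, h₂, h₃⟩ := hF.exists_top i (f i) hab.symm hbc hac
      exact ⟨e, fun hn => (hi hn).elim, fun _ => h₁, h₂, h₃⟩
  choose g h₁ h₂ h₃ h₄ using key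
  exact (hF.indep g f a c h₄).strictRel (hF.strict_trans (h g h₁ h₂) (hF.pareto g b c h₃))

theorem imposes_left (hF : IsArrovian pref F) {D : Finset ι} {a b c : W} (hab : a ≠ b)
    (hca : c ≠ a) (hcb : c ≠ b) (h : ImposesAgainst pref F D a b) : Imposes pref F D c b := by
  intro f hf
  have key : ∀ i, ∃ e, (i ∈ D → StrictRel (pref i e) a b) ∧
      (i ∉ D → StrictRel (pref i e) b a) ∧ StrictRel (pref i e) c a ∧
      SameOnPair (pref i e) (pref i (f i)) c b := by
    intro i
    by_cases hi : i ∈ D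
    · obtain ⟨e, h₁, h₂, h₃⟩ := hF.exists_strict i c a b hca hcb hab
      exact ⟨e, fun _ => h₂, fun hn => (hn hi).elim, h₁, h₃.sameOnPair (hf i hi)⟩
    · obtain ⟨e, h₁, h₂, h₃⟩ := hF.exists_bottom i (f i) hca hab.symm hcb
      exact ⟨e, fun hn => (hi hn).elim, fun _ => h₂, h₁, h₃⟩
  choose g h₁ h₂ h₃ h₄ using key
  exact (hF.indep g f c b h₄).strictRel (hF.strict_trans (hF.pareto g c a h₃) (h g h₁ h₂))

theorem imposes_all (hF : IsArrovian pref F) (hthird : ∀ a b : W, ∃ c, c ≠ a ∧ c ≠ b)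
    {D : Finset ι} {a b : W} (hab : a ≠ b) (h : ImposesAgainst pref F D a b) {x y : W}
    (hxy : x ≠ y) : Imposes pref F D x y := by
  have from_a : ∀ z, z ≠ a → Imposes pref F D a z := by
    intro z hz
    by_cases hzb : z = b
    · subst hzb
      obtain ⟨c, hca, hcz⟩ := hthird a z
      exact hF.imposes_right hca.symm hab hcz
        (hF.imposes_right hab hca.symm hcz.symm h).against
    · exact hF.imposes_right hab hz.symm (Ne.symm hzb) h
  by_cases hxa : x = a
  · subst hxa
    exact from_a y hxy.symm
  · by_cases hya : y = a
    · subst hya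
      obtain ⟨c, hcx, hcy⟩ := hthird x y
      exact hF.imposes_right hcx.symm hxy hcy
        (hF.imposes_left hcy.symm hxy hcx.symm (from_a c hcy).against).against
    · exact hF.imposes_left (Ne.symm hya) hxa hxy (from_a y hya).against

/-- Arrow's theorem on domains with the free triple property. -/
theorem exists_dictator [Fintype ι] [Nonempty W] (hF : IsArrovian pref F)
    (hthird : ∀ a b : W, ∃ c, c ≠ a ∧ c ≠ b) :
    ∃ d, ∀ f a b, StrictRel (pref d (f d)) a b → StrictRel (F f) a b := by
  classical
  have huniv : ∃ D : Finset ι, ∃ a b, a ≠ b ∧ ImposesAgainst pref F D a b := by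
    obtain ⟨a⟩ := ‹Nonempty W›
    obtain ⟨b, hb, -⟩ := hthird a a
    exact ⟨Finset.univ, a, b, hb.symm, fun f hf _ => hF.pareto f a b fun i => hf i (by simp)⟩
  obtain ⟨D, ⟨a, b, hab, hD⟩, hmin⟩ := exists_minimal_of_wellFoundedLT _ huniv
  obtain ⟨c, hca, hcb⟩ := hthird a b
  obtain ⟨d, hd⟩ : D.Nonempty := by
    by_contra hne
    rw [Finset.not_nonempty_iff_eq_empty] at hne
    subst hne
    choose g h₁ h₂ h₃ using fun i => hF.exists_strict i b a c hab.symm hcb.symm hca.symm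
    exact (hD g (by simp) fun i _ => h₁ i).2 (hF.pareto g b a h₁).1
  suffices hsingle : ∃ x y, x ≠ y ∧ ImposesAgainst pref F {d} x y by
    obtain ⟨x, y, hxy, h⟩ := hsingle
    refine ⟨d, fun f u v huv => hF.imposes_all hthird hxy h ?_ f (by simpa using huv)⟩
    rintro rfl
    exact huv.2 huv.1
  have key : ∀ i, ∃ e, (i = d → StrictRel (pref i e) a c) ∧ (i ≠ d → StrictRel (pref i e) c a) ∧
      (i ∈ D → StrictRel (pref i e) a b) ∧ (i ∉ D → StrictRel (pref i e) b a) ∧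
      (i ∈ D.erase d → StrictRel (pref i e) c b) ∧
      (i ∉ D.erase d → StrictRel (pref i e) b c) := by
    intro i
    by_cases hid : i = d
    · subst hid
      obtain ⟨e, h₁, h₂, h₃⟩ := hF.exists_strict i a b c hab hca.symm hcb.symm
      exact ⟨e, by simp [*]⟩
    by_cases hi : i ∈ D
    · obtain ⟨e, h₁, h₂, h₃⟩ := hF.exists_strict i c a b hca hcb hab
      exact ⟨e, by simp [*]⟩
    · obtain ⟨e, h₁, h₂, h₃⟩ := hF.exists_strict i b c a hcb.symm hab.symm hca
      exact ⟨e, by simp [*]⟩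
  choose g hac hca' hab' hba hcb' hbc using key
  have hsoc := hD g hab' hba
  by_cases hsoc' : F g c a
  · have hcb_soc : StrictRel (F g) c b :=
      ⟨hF.trans g c a b hsoc' hsoc.1, fun h => hsoc.2 (hF.trans g b c a h hsoc')⟩
    have herase : ImposesAgainst pref F (D.erase d) c b := by
      intro f hf hf'
      refine (hF.indep g f c b fun i => ?_).strictRel hcb_soc
      by_cases hi : i ∈ D.erase d
      · exact (hcb' i hi).sameOnPair (hf i hi)
      · exact ((hbc i hi).sameOnPair (hf' i hi)).swap
    have hle := hmin ⟨c, b, hcb, herase⟩ (Finset.erase_subset d D) hd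
    simp at hle
  · refine ⟨a, c, hca.symm, fun f hf hf' => ?_⟩
    refine (hF.indep g f a c fun i => ?_).strictRel
      ⟨(hF.total g a c).resolve_right hsoc', hsoc'⟩
    by_cases hi : i = d
    · exact (hac i hi).sameOnPair (hf i (by simpa using hi))
    · exact ((hca' i hi).sameOnPair (hf' i (by simpa using hi))).swap

end IsArrovian

end Arrow

section RevealedPreference

variable {S ℰ W : Type}

/-- The preference revealed by the choices of `nab` on two-element belief bases. -/
def revealedPref (B : ℰ → Set W) (nab : Profile S ℰ → ℰ → ℰ) (Φ : Profile S ℰ) (a b : W) :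
    Prop :=
  ∃ E, B E = {a, b} ∧ a ∈ B (nab Φ E)

theorem Profile.Equiv.refl [LinearOrder S] (Φ : Profile S ℰ) : Profile.Equiv Φ Φ :=
  ⟨rfl, fun _ => rfl⟩

variable [LinearOrder S] {B : ℰ → Set W} {nab : Profile S ℰ → ℰ → ℰ}

theorem BasicFusion.congr (h : BasicFusion B nab) (Φ : Profile S ℰ) {E E' : ℰ}
    (hE : B E = B E') : B (nab Φ E) = B (nab Φ E') :=
  h.2.1 Φ Φ E E' (.refl Φ) hE

theorem BasicFusion.revealedPref_iff (h : BasicFusion B nab) (Φ : Profile S ℰ) {E : ℰ} {a b : W}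
    (hE : B E = {a, b}) : revealedPref B nab Φ a b ↔ a ∈ B (nab Φ E) := by
  refine ⟨?_, fun ha => ⟨E, hE, ha⟩⟩
  rintro ⟨E', hE', ha⟩
  rwa [h.congr Φ (hE.trans hE'.symm)]

theorem BasicFusion.revealedPref_iff' (h : BasicFusion B nab) (Φ : Profile S ℰ) {E : ℰ}
    {a b : W} (hE : B E = {a, b}) : revealedPref B nab Φ b a ↔ b ∈ B (nab Φ E) :=
  h.revealedPref_iff Φ (by rw [hE, Set.pair_comm])

theorem BasicFusion.revealedPref_of_mem (h : BasicFusion B nab)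
    (hsurj : ∀ A : Set W, A.Nonempty → ∃ E : ℰ, B E = A) {Φ : Profile S ℰ} {E : ℰ} {a b : W}
    (ha : a ∈ B (nab Φ E)) (hb : b ∈ B E) : revealedPref B nab Φ a b := by
  obtain ⟨E₂, hE₂⟩ := hsurj {a, b} (by simp)
  have hsub : B E₂ ⊆ B E := by
    rw [hE₂]
    rintro x (rfl | rfl)
    exacts [h.1 Φ E ha, hb]
  exact ⟨E₂, hE₂, h.2.2.1 Φ E₂ E E₂ (Set.inter_eq_right.2 hsub).symm ⟨ha, by simp [hE₂]⟩⟩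

theorem BasicFusion.mem_of_revealedPref (h : BasicFusion B nab) {Φ : Profile S ℰ} {E : ℰ}
    {a b : W} (ha : a ∈ B E) (hb : b ∈ B (nab Φ E)) (hab : revealedPref B nab Φ a b) :
    a ∈ B (nab Φ E) := by
  obtain ⟨E₂, hE₂, ha₂⟩ := hab
  have hsub : B E₂ ⊆ B E := by
    rw [hE₂]
    rintro x (rfl | rfl)
    exacts [ha, h.1 Φ E hb]
  exact (h.2.2.2 Φ E₂ E E₂ (Set.inter_eq_right.2 hsub).symm ⟨b, hb, by simp [hE₂]⟩ ha₂).1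

theorem BasicFusion.revealedPref_total (h : BasicFusion B nab) (hB : ∀ E : ℰ, (B E).Nonempty)
    (hsurj : ∀ A : Set W, A.Nonempty → ∃ E : ℰ, B E = A) (Φ : Profile S ℰ) (a b : W) :
    revealedPref B nab Φ a b ∨ revealedPref B nab Φ b a := by
  obtain ⟨E, hE⟩ := hsurj {a, b} (by simp)
  obtain ⟨x, hx⟩ := hB (nab Φ E)
  rw [h.revealedPref_iff Φ hE, h.revealedPref_iff' Φ hE]
  have hx' := h.1 Φ E hx
  rw [hE] at hx'
  rcases hx' with rfl | rfl
  exacts [.inl hx, .inr hx]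

theorem BasicFusion.revealedPref_trans (h : BasicFusion B nab) (hB : ∀ E : ℰ, (B E).Nonempty)
    (hsurj : ∀ A : Set W, A.Nonempty → ∃ E : ℰ, B E = A) (Φ : Profile S ℰ) (a b c : W)
    (hab : revealedPref B nab Φ a b) (hbc : revealedPref B nab Φ b c) :
    revealedPref B nab Φ a c := by
  obtain ⟨E, hE⟩ := hsurj {a, b, c} (by simp)
  obtain ⟨x, hx⟩ := hB (nab Φ E)
  have hc : c ∈ B E := by simp [hE]
  have hb_a : b ∈ B (nab Φ E) → a ∈ B (nab Φ E) :=
    fun hb => h.mem_of_revealedPref (by simp [hE]) hb hab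
  have hx' := h.1 Φ E hx
  rw [hE] at hx'
  refine h.revealedPref_of_mem hsurj ?_ hc
  rcases hx' with rfl | rfl | rfl
  exacts [hx, hb_a hx, hb_a (h.mem_of_revealedPref (by simp [hE]) hx hbc)]

theorem BasicFusion.eq_on_subset_pair (h : BasicFusion B nab) (hB : ∀ E : ℰ, (B E).Nonempty)
    {Φ Ψ : Profile S ℰ} {a b : W}
    (hs : SameOnPair (revealedPref B nab Φ) (revealedPref B nab Ψ) a b) {E : ℰ}
    (hE : B E ⊆ {a, b}) : B (nab Φ E) = B (nab Ψ E) := by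
  have hsingle : ∀ (x : W) (Φ : Profile S ℰ), B E = {x} → B (nab Φ E) = {x} := fun x Φ hx =>
    (hB _).subset_singleton_iff.1 (hx ▸ h.1 Φ E)
  rcases Set.subset_pair_iff_eq.1 hE with h0 | h1 | h2 | h3
  · exact ((hB E).ne_empty h0).elim
  · rw [hsingle a Φ h1, hsingle a Ψ h1]
  · rw [hsingle b Φ h2, hsingle b Ψ h2]
  · ext x
    constructor <;> intro hx <;> have hx' := h.1 _ E hx <;> rw [h3] at hx' <;>
      rcases hx' with rfl | rfl
    · exact (h.revealedPref_iff Ψ h3).1 (hs.1.1 ((h.revealedPref_iff Φ h3).2 hx))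
    · exact (h.revealedPref_iff' Ψ h3).1 (hs.2.1 ((h.revealedPref_iff' Φ h3).2 hx))
    · exact (h.revealedPref_iff Φ h3).1 (hs.1.2 ((h.revealedPref_iff Ψ h3).2 hx))
    · exact (h.revealedPref_iff' Φ h3).1 (hs.2.2 ((h.revealedPref_iff' Ψ h3).2 hx))

theorem BasicFusion.sameOnPair_of_eq (h : BasicFusion B nab)
    {Φ Ψ : Profile S ℰ} {a b : W} {E : ℰ} (hE : B E = {a, b})
    (heq : B (nab Φ E) = B (nab Ψ E)) :
    SameOnPair (revealedPref B nab Φ) (revealedPref B nab Ψ) a b := by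
  simp [SameOnPair, h.revealedPref_iff _ hE, h.revealedPref_iff' _ hE, heq]

theorem BasicFusion.propInd_s19 (h : BasicFusion B nab) (hB : ∀ E : ℰ, (B E).Nonempty)
    (hsurj : ∀ A : Set W, A.Nonempty → ∃ E : ℰ, B E = A) (hi : ESFI B nab) :
    PropInd (revealedPref B nab) := by
  intro N hN f g a b hs
  obtain ⟨E, hE⟩ := hsurj {a, b} (by simp)
  exact h.sameOnPair_of_eq hE
    (hi N hN f g E fun E' hE' j => h.eq_on_subset_pair hB (hs j) (hE ▸ hE'))

theorem BasicFusion.propP (h : BasicFusion B nab) (hB : ∀ E : ℰ, (B E).Nonempty)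
    (hsurj : ∀ A : Set W, A.Nonempty → ∃ E : ℰ, B E = A) (hu : ESFU B nab) (hi : ESFI B nab) :
    PropP (revealedPref B nab) := by
  rintro ⟨N, hN, f⟩ a b hs
  obtain ⟨i, hiN⟩ := id hN
  obtain ⟨E, hE⟩ := hsurj {a, b} (by simp)
  let k : {x // x ∈ N} := ⟨i, hiN⟩
  have hconst (j : {x // x ∈ N}) :
      SameOnPair (revealedPref B nab ⟨N, hN, fun _ => f k⟩)
        (revealedPref B nab (Profile.single j.1 (f k))) a b :=
    h.sameOnPair_of_eq hE (hu ⟨N, hN, fun _ => f k⟩ (fun _ _ => rfl) E j)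
  have hk : StrictRel (revealedPref B nab ⟨N, hN, fun _ => f k⟩) a b :=
    SameOnPair.strictRel ⟨(hconst k).1.symm, (hconst k).2.symm⟩ (hs k)
  refine (h.propInd_s19 hB hsurj hi N hN (fun _ => f k) f a b fun j => ?_).strictRel hk
  exact ((hconst j).strictRel hk).sameOnPair (hs j)

theorem BasicFusion.isArrovian (h : BasicFusion B nab) (hB : ∀ E : ℰ, (B E).Nonempty)
    (hsurj : ∀ A : Set W, A.Nonempty → ∃ E : ℰ, B E = A) (hsd : ESFSD B nab) (hu : ESFU B nab)
    (hi : ESFI B nab) (N : Finset S) (hN : N.Nonempty) :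
    IsArrovian (fun (i : {x // x ∈ N}) e => revealedPref B nab (Profile.single i.1 e))
      (fun f => revealedPref B nab ⟨N, hN, f⟩) := by
  have htrans := fun Φ : Profile S ℰ => h.revealedPref_trans hB hsurj Φ
  refine ⟨fun _ _ => h.revealedPref_total hB hsurj _, fun _ => h.revealedPref_total hB hsurj _,
    fun _ => htrans _, fun f => h.propP hB hsurj hu hi ⟨N, hN, f⟩,
    fun f g => h.propInd_s19 hB hsurj hi N hN f g, ?_, ?_, ?_⟩
  all_goals
    intro i a b c hab hac hbc
    obtain ⟨E₁, hE₁⟩ := hsurj {a, b} (by simp)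
    obtain ⟨E₂, hE₂⟩ := hsurj {b, c} (by simp)
    obtain ⟨-, ⟨e₂, h₂, h₂'⟩, ⟨e₃, h₃, h₃'⟩, ⟨e₄, h₄, h₄'⟩⟩ :=
      hsd i.1 a b c hab hac hbc E₁ E₂ hE₁ hE₂
  · have hs₁ : StrictRel (revealedPref B nab (Profile.single i.1 e₄)) a b := by
      simp [StrictRel, h.revealedPref_iff _ hE₁, h.revealedPref_iff' _ hE₁, h₄, hab.symm]
    have hs₂ : StrictRel (revealedPref B nab (Profile.single i.1 e₄)) b c := by
      simp [StrictRel, h.revealedPref_iff _ hE₂, h.revealedPref_iff' _ hE₂, h₄', hbc.symm]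
    exact ⟨e₄, hs₁, hs₂, htrans _ _ _ _ hs₁.1 hs₂.1, fun hca =>
      hs₁.2 (htrans _ _ _ _ hs₂.1 hca)⟩
  · have hs₁ : StrictRel (revealedPref B nab (Profile.single i.1 e₃)) a b := by
      simp [StrictRel, h.revealedPref_iff _ hE₁, h.revealedPref_iff' _ hE₁, h₃, hab.symm]
    have hbc' : revealedPref B nab (Profile.single i.1 e₃) b c := by
      simp [h.revealedPref_iff _ hE₂, h₃']
    have hcb' : revealedPref B nab (Profile.single i.1 e₃) c b := by
      simp [h.revealedPref_iff' _ hE₂, h₃']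
    exact ⟨e₃, hs₁, ⟨htrans _ _ _ _ hs₁.1 hbc', fun hca =>
      hs₁.2 (htrans _ _ _ _ hbc' hca)⟩, hbc', hcb'⟩
  · have hs₂ : StrictRel (revealedPref B nab (Profile.single i.1 e₂)) b c := by
      simp [StrictRel, h.revealedPref_iff _ hE₂, h.revealedPref_iff' _ hE₂, h₂', hbc.symm]
    have hab' : revealedPref B nab (Profile.single i.1 e₂) a b := by
      simp [h.revealedPref_iff _ hE₁, h₂]
    have hba' : revealedPref B nab (Profile.single i.1 e₂) b a := by
      simp [h.revealedPref_iff' _ hE₁, h₂]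
    exact ⟨e₂, hab', hba', ⟨htrans _ _ _ _ hab' hs₂.1, fun hca =>
      hs₂.2 (htrans _ _ _ _ hca hab')⟩, hs₂⟩

end RevealedPreference

end BeliefMerging

open BeliefMerging in
/-- An ES basic fusion operator satisfying (ESF-SD), (ESF-U) and (ESF-I)
is dictatorial. -/
theorem impossibility_unanimity
    {S ℰ W : Type} [LinearOrder S] [Nonempty S] [Fintype W] [Nonempty W]
    (hcard : 4 ≤ Fintype.card W)
    (B : ℰ → Set W) (hB : ∀ E : ℰ, (B E).Nonempty)
    (hsurj : ∀ A : Set W, A.Nonempty → ∃ E : ℰ, B E = A)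
    (nab : Profile S ℰ → ℰ → ℰ) (hbf : BasicFusion B nab)
    (hsd : ESFSD B nab) (hu : ESFU B nab) (hi : ESFI B nab) :
    ESFD B nab := by
  classical
  intro N hN
  have hthird : ∀ a b : W, ∃ c, c ≠ a ∧ c ≠ b := by
    intro a b
    have hlt : ({a, b} : Finset W).card < Fintype.card W :=
      Finset.card_le_two.trans_lt (by omega)
    obtain ⟨c, hc⟩ := Finset.exists_mem_notMem_of_card_lt_card
      (hlt.trans_eq Finset.card_univ.symm)
    exact ⟨c, by simpa using hc⟩
  obtain ⟨d, hd⟩ := (hbf.isArrovian hB hsurj hsd hu hi N hN).exists_dictator hthird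
  refine ⟨d, fun f E w hw => ?_⟩
  obtain ⟨v, hv⟩ := hB (nab (Profile.single d.1 (f d)) E)
  have hwE := hbf.1 _ E hw
  have hvE := hbf.1 _ E hv
  refine hbf.mem_of_revealedPref hwE hv ?_
  by_contra hwv
  exact (hd f v w ⟨hbf.revealedPref_of_mem hsurj hv hwE, hwv⟩).2
    (hbf.revealedPref_of_mem hsurj hw hvE)
end
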